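/- Let α ≥ 0 and let f ∈ H⁰_α be continuous on ℝ^d. (1) The functions x ↦ f*_α(x) and x ↦ f♯_α(x) are continuous on ℝ^d. (2) If moreover f is locally γ-Hölder continuous for some γ ∈ (0,1] (i.e. (x,y) ↦ |f(x) − f(y)|/|x − y|^γ is bounded on every compact subset of ℝ^d × ℝ^d minus the diagonal), then f*_α and f♯_α are locally Hölder continuous with exponent γ/(1+γ). -/

import Mathlib

open MeasureTheory Real Set
open scoped ENNReal

noncomputable section

/-- The pointwise maximal heat quantity
`f*_α(x) = sup_{τ>0} (1+τ)^α ∫ (2πτ)^{-d/2} e^{-|x-y|²/(2τ)} |f(y)| dy ∈ [0,∞]`. -/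
def fstar {d : ℕ} (α : ℝ) (f : EuclideanSpace ℝ (Fin d) → ℝ)
    (x : EuclideanSpace ℝ (Fin d)) : ℝ≥0∞ :=
  ⨆ τ ∈ Set.Ioi (0:ℝ), ENNReal.ofReal ((1 + τ) ^ α) *
    ∫⁻ y, ENNReal.ofReal ((2 * π * τ) ^ (-(d:ℝ)/2) * Real.exp (-‖x - y‖^2 / (2 * τ)) * |f y|)

/-- The pointwise maximal-function quantity
`f♯_α(x) = sup_{ρ>0} (1+ρ²)^α ⨍_{B(x,ρ)} |f| ∈ [0,∞]`. -/
def fsharp {d : ℕ} (α : ℝ) (f : EuclideanSpace ℝ (Fin d) → ℝ)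
    (x : EuclideanSpace ℝ (Fin d)) : ℝ≥0∞ :=
  ⨆ ρ ∈ Set.Ioi (0:ℝ), ENNReal.ofReal ((1 + ρ ^ 2) ^ α) *
    ((∫⁻ y in Metric.ball x ρ, ENNReal.ofReal |f y|) / volume (Metric.ball x ρ))

/-- The space `H⁰_α`: locally integrable functions with `f*_α(x) < ∞` for every `x`. -/
def MemH0 {d : ℕ} (α : ℝ) (f : EuclideanSpace ℝ (Fin d) → ℝ) : Prop :=
  LocallyIntegrable f (volume : Measure (EuclideanSpace ℝ (Fin d))) ∧ ∀ x, fstar α f x < ⊤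

def PP {d : ℕ} (f : EuclideanSpace ℝ (Fin d) → ℝ) (τ : ℝ) (x : EuclideanSpace ℝ (Fin d)) : ℝ≥0∞ :=
  ∫⁻ y, ENNReal.ofReal ((2 * π * τ) ^ (-(d:ℝ)/2) * Real.exp (-‖x - y‖^2 / (2 * τ)) * |f y|)

def AA {d : ℕ} (f : EuclideanSpace ℝ (Fin d) → ℝ) (ρ : ℝ) (x : EuclideanSpace ℝ (Fin d)) : ℝ≥0∞ :=
  ((∫⁻ y in Metric.ball x ρ, ENNReal.ofReal |f y|) / volume (Metric.ball x ρ))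

theorem le_fstar {d : ℕ} (α : ℝ) (f : EuclideanSpace ℝ (Fin d) → ℝ) (x) (τ : ℝ) (h : 0 < τ) :
    ENNReal.ofReal ((1 + τ) ^ α) * PP f τ x ≤ fstar α f x := by
  unfold fstar
  exact le_iSup₂_of_le (f := fun (τ : ℝ) (_ : τ ∈ Set.Ioi (0:ℝ)) => ENNReal.ofReal ((1 + τ) ^ α) * PP f τ x) τ h le_rfl

theorem fstar_le {d : ℕ} (α : ℝ) (f : EuclideanSpace ℝ (Fin d) → ℝ) (x) (M : ℝ≥0∞)
    (h : ∀ τ : ℝ, 0 < τ → ENNReal.ofReal ((1 + τ) ^ α) * PP f τ x ≤ M) : fstar α f x ≤ M := by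
  unfold fstar
  exact iSup₂_le h

theorem le_fsharp {d : ℕ} (α : ℝ) (f : EuclideanSpace ℝ (Fin d) → ℝ) (x) (τ : ℝ) (h : 0 < τ) :
    ENNReal.ofReal ((1 + τ ^ 2) ^ α) * AA f τ x ≤ fsharp α f x := by
  unfold fsharp
  exact le_iSup₂_of_le (f := fun (τ : ℝ) (_ : τ ∈ Set.Ioi (0:ℝ)) => ENNReal.ofReal ((1 + τ ^ 2) ^ α) * AA f τ x) τ h le_rfl

theorem fsharp_le {d : ℕ} (α : ℝ) (f : EuclideanSpace ℝ (Fin d) → ℝ) (x) (M : ℝ≥0∞)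
    (h : ∀ τ : ℝ, 0 < τ → ENNReal.ofReal ((1 + τ ^ 2) ^ α) * AA f τ x ≤ M) : fsharp α f x ≤ M := by
  unfold fsharp
  exact iSup₂_le h

theorem exp_cvx (a t : ℝ) (h0 : 0 ≤ t) (h1 : t ≤ 1) : Real.exp (a * t) ≤ 1 + t * Real.exp a := by
  have := convexOn_exp.2 (mem_univ (0:ℝ)) (mem_univ a) (sub_nonneg.2 h1) h0 (by ring)
  simp only [smul_eq_mul, mul_zero, zero_add, Real.exp_zero, mul_one] at this
  rw [mul_comm a t]
  linarith

theorem PP_compare {d : ℕ} (f : EuclideanSpace ℝ (Fin d) → ℝ) (τ ε : ℝ) (hτ : 0 < τ) (hε : 0 < ε)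
    (x x0 : EuclideanSpace ℝ (Fin d)) :
    PP f τ x ≤ ENNReal.ofReal ((1 + ε) ^ ((d:ℝ)/2) * Real.exp (‖x - x0‖^2 / (2 * τ * ε))) *
      PP f (τ * (1 + ε)) x0 := by
  unfold PP
  rw [← lintegral_const_mul' _ _ ENNReal.ofReal_ne_top]
  refine lintegral_mono fun y => ?_
  rw [← ENNReal.ofReal_mul (by positivity)]
  refine ENNReal.ofReal_le_ofReal ?_
  rw [← mul_assoc]
  refine mul_le_mul_of_nonneg_right ?_ (abs_nonneg _)
  have e1 : (2 * π * (τ * (1 + ε))) ^ (-(d:ℝ)/2) =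
      (2 * π * τ) ^ (-(d:ℝ)/2) * ((1 + ε) ^ ((d:ℝ)/2))⁻¹ := by
    rw [← mul_assoc, Real.mul_rpow (by positivity) (by positivity), neg_div,
      Real.rpow_neg (x := 1 + ε) (by positivity)]
  have hp : 0 < (1 + ε) ^ ((d:ℝ)/2) := by positivity
  have e2 : (1 + ε) ^ ((d:ℝ)/2) * Real.exp (‖x - x0‖^2 / (2 * τ * ε)) *
      ((2 * π * (τ * (1 + ε))) ^ (-(d:ℝ)/2) * Real.exp (-‖x0 - y‖^2 / (2 * (τ * (1 + ε))))) =
      (2 * π * τ) ^ (-(d:ℝ)/2) * Real.exp (‖x - x0‖^2 / (2 * τ * ε) + -‖x0 - y‖^2 / (2 * (τ * (1 + ε)))) := by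
    rw [e1, Real.exp_add]
    field_simp
  rw [e2]
  refine mul_le_mul_of_nonneg_left (Real.exp_le_exp.2 ?_) (by positivity)
  have ht : ‖x0 - y‖ ≤ ‖x - y‖ + ‖x - x0‖ := by
    have := norm_sub_le (x - y) (x - x0)
    simpa using this
  set a := ‖x - y‖
  set b := ‖x0 - y‖
  set D := ‖x - x0‖
  have hb : b ^ 2 ≤ (a + D) ^ 2 := by gcongr
  have key : ε * b ^ 2 ≤ (1 + ε) * D ^ 2 + ε * (1 + ε) * a ^ 2 := by
    nlinarith [sq_nonneg (ε * a - D)]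
  have : D ^ 2 / (2 * τ * ε) + -b ^ 2 / (2 * (τ * (1 + ε))) - (-a ^ 2 / (2 * τ)) =
      ((1 + ε) * D ^ 2 + ε * (1 + ε) * a ^ 2 - ε * b ^ 2) / (2 * τ * ε * (1 + ε)) := by
    field_simp
    ring
  have h2 : 0 ≤ ((1 + ε) * D ^ 2 + ε * (1 + ε) * a ^ 2 - ε * b ^ 2) / (2 * τ * ε * (1 + ε)) :=
    div_nonneg (by linarith) (by positivity)
  linarith

theorem PP_shift {d : ℕ} (f : EuclideanSpace ℝ (Fin d) → ℝ) (τ : ℝ) (x : EuclideanSpace ℝ (Fin d)) :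
    PP f τ x = ∫⁻ z, ENNReal.ofReal ((2 * π * τ) ^ (-(d:ℝ)/2) * Real.exp (-‖z‖^2 / (2 * τ)) * |f (x + z)|) := by
  unfold PP
  rw [← lintegral_add_left_eq_self _ x]
  refine lintegral_congr fun z => ?_
  simp

theorem mass {d : ℕ} (τ : ℝ) (hτ : 0 < τ) :
    ∫⁻ z : EuclideanSpace ℝ (Fin d), ENNReal.ofReal ((2 * π * τ) ^ (-(d:ℝ)/2) * Real.exp (-‖z‖^2 / (2 * τ))) = 1 := by
  have hb : 0 < 1 / (2 * τ) := by positivity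
  have h1 := GaussianFourier.integral_rexp_neg_mul_sq_norm (V := EuclideanSpace ℝ (Fin d)) hb
  have e : ∀ z : EuclideanSpace ℝ (Fin d), Real.exp (-‖z‖^2 / (2 * τ)) = Real.exp (-(1 / (2 * τ)) * ‖z‖^2) := by
    intro z; congr 1; ring
  have hpos : 0 < (π / (1 / (2 * τ))) ^ ((Module.finrank ℝ (EuclideanSpace ℝ (Fin d)) : ℝ) / 2) := by positivity
  have hint : Integrable (fun z : EuclideanSpace ℝ (Fin d) => Real.exp (-(1 / (2 * τ)) * ‖z‖^2)) := by
    by_contra hc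
    rw [integral_undef hc] at h1
    linarith
  simp_rw [e]
  rw [← ofReal_integral_eq_lintegral_ofReal (hint.const_mul _) (ae_of_all _ fun z => by positivity),
    integral_const_mul, h1]
  have : π / (1 / (2 * τ)) = 2 * π * τ := by field_simp
  rw [this, finrank_euclideanSpace_fin, ← Real.rpow_add (by positivity), neg_div, neg_add_cancel]
  simp

def Ct (d : ℕ) : ℝ := 2 ^ ((d:ℝ)/2) * 4 ^ (d+1) * ((d+1).factorial : ℝ)

theorem Ct_nonneg (d : ℕ) : 0 ≤ Ct d := by unfold Ct; positivity

theorem tail {d : ℕ} (τ r : ℝ) (hτ : 0 < τ) (hτ1 : τ ≤ 1) (hr : 1 ≤ r) (hd : 1 ≤ d) :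
    (2 * π * τ) ^ (-(d:ℝ)/2) * Real.exp (-r^2 / (2 * τ)) ≤
      Ct d * τ * ((2 * π * 2) ^ (-(d:ℝ)/2) * Real.exp (-r^2 / (2 * 2))) := by
  have e1 : (2 * π * τ) ^ (-(d:ℝ)/2) = (2 * π) ^ (-(d:ℝ)/2) * τ ^ (-(d:ℝ)/2) :=
    Real.mul_rpow (by positivity) hτ.le
  have e2 : (2 * π * 2) ^ (-(d:ℝ)/2) = (2 * π) ^ (-(d:ℝ)/2) * (2 ^ ((d:ℝ)/2))⁻¹ := by
    rw [Real.mul_rpow (by positivity) (by positivity), neg_div, Real.rpow_neg (x := 2) (by positivity)]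
  have h3 : Real.exp (-r^2 / (2 * τ)) ≤ Real.exp (-(1/(4*τ))) * Real.exp (-r^2 / (2 * 2)) := by
    rw [← Real.exp_add]
    refine Real.exp_le_exp.2 ?_
    have : -(1/(4*τ)) + -r^2 / (2 * 2) - (-r^2 / (2 * τ)) = ((r^2 - 1) + r^2 * (1 - τ)) / (4 * τ) := by
      field_simp
      ring
    have h : 0 ≤ ((r^2 - 1) + r^2 * (1 - τ)) / (4 * τ) := by
      apply div_nonneg _ (by positivity)
      have : 0 ≤ r^2 * (1 - τ) := mul_nonneg (by positivity) (by linarith)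
      nlinarith
    linarith
  have h4 : τ ^ (-(d:ℝ)/2) * Real.exp (-(1/(4*τ))) ≤ 4 ^ (d+1) * ((d+1).factorial : ℝ) * τ := by
    have h5 : τ ^ (-(d:ℝ)/2) ≤ τ ^ (-(d:ℝ)) := by
      apply Real.rpow_le_rpow_of_exponent_ge hτ hτ1
      have : (0:ℝ) ≤ d := by positivity
      linarith
    rw [Real.rpow_neg hτ.le, Real.rpow_natCast] at h5
    have h6 := Real.pow_div_factorial_le_exp (1/(4*τ)) (by positivity) (d+1)
    rw [div_le_iff₀ (by positivity)] at h6
    rw [Real.exp_neg, ← div_eq_mul_inv, div_le_iff₀ (Real.exp_pos _)]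
    calc τ ^ (-(d:ℝ)/2) ≤ (τ ^ d)⁻¹ := h5
      _ = 4 ^ (d+1) * τ * (1/(4*τ)) ^ (d+1) := by
        rw [div_pow, mul_pow, one_pow]; field_simp; ring
      _ ≤ 4 ^ (d+1) * τ * (Real.exp (1/(4*τ)) * ((d+1).factorial : ℝ)) := by gcongr
      _ = _ := by ring
  have hp : (0:ℝ) < 2 ^ ((d:ℝ)/2) := by positivity
  calc _ ≤ (2 * π) ^ (-(d:ℝ)/2) * τ ^ (-(d:ℝ)/2) * (Real.exp (-(1/(4*τ))) * Real.exp (-r^2 / (2 * 2))) := by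
        rw [e1]; gcongr
    _ = (2 * π) ^ (-(d:ℝ)/2) * (τ ^ (-(d:ℝ)/2) * Real.exp (-(1/(4*τ)))) * Real.exp (-r^2 / (2 * 2)) := by ring
    _ ≤ (2 * π) ^ (-(d:ℝ)/2) * (4 ^ (d+1) * ((d+1).factorial : ℝ) * τ) * Real.exp (-r^2 / (2 * 2)) := by gcongr
    _ = _ := by
      rw [e2]; unfold Ct; field_simp

theorem PP_small {d : ℕ} (hd : 1 ≤ d) (f : EuclideanSpace ℝ (Fin d) → ℝ) (hf : Continuous f) (τ η : ℝ) (hτ : 0 < τ)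
    (hτ1 : τ ≤ 1) (hη : 0 ≤ η) (x x0 : EuclideanSpace ℝ (Fin d))
    (h : ∀ z, ‖z‖ ≤ 1 → |f (x + z)| ≤ |f (x0 + z)| + η) :
    PP f τ x ≤ PP f τ x0 + ENNReal.ofReal η + ENNReal.ofReal (Ct d * τ) * PP f 2 x := by
  have hC := Ct_nonneg d
  have e1 : ENNReal.ofReal η = ∫⁻ z : EuclideanSpace ℝ (Fin d), ENNReal.ofReal η * ENNReal.ofReal ((2 * π * τ) ^ (-(d:ℝ)/2) * Real.exp (-‖z‖^2 / (2 * τ))) := by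
    rw [lintegral_const_mul' _ _ ENNReal.ofReal_ne_top, mass τ hτ, mul_one]
  rw [e1, PP_shift, PP_shift, PP_shift f 2, ← lintegral_const_mul' _ _ ENNReal.ofReal_ne_top,
    ← lintegral_add_left (by fun_prop), ← lintegral_add_left (by fun_prop)]
  refine lintegral_mono fun z => ?_
  rw [← ENNReal.ofReal_mul hη, ← ENNReal.ofReal_mul (by positivity), ← ENNReal.ofReal_add (by positivity) (by positivity),
    ← ENNReal.ofReal_add (by positivity) (by positivity)]
  refine ENNReal.ofReal_le_ofReal ?_
  rcases le_total ‖z‖ 1 with hz | hz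
  · have h1 : (2 * π * τ) ^ (-(d:ℝ)/2) * Real.exp (-‖z‖^2 / (2 * τ)) * |f (x + z)| ≤
      (2 * π * τ) ^ (-(d:ℝ)/2) * Real.exp (-‖z‖^2 / (2 * τ)) * (|f (x0 + z)| + η) :=
      mul_le_mul_of_nonneg_left (h z hz) (by positivity)
    have h2 : 0 ≤ Ct d * τ * ((2 * π * 2) ^ (-(d:ℝ)/2) * Real.exp (-‖z‖^2 / (2 * 2)) * |f (x + z)|) := by positivity
    linarith
  · have h1 := mul_le_mul_of_nonneg_right (tail τ ‖z‖ hτ hτ1 hz hd) (abs_nonneg (f (x + z)))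
    have h2 : 0 ≤ (2 * π * τ) ^ (-(d:ℝ)/2) * Real.exp (-‖z‖^2 / (2 * τ)) * |f (x0 + z)| := by positivity
    have h3 : 0 ≤ η * ((2 * π * τ) ^ (-(d:ℝ)/2) * Real.exp (-‖z‖^2 / (2 * τ))) := by positivity
    linarith

theorem W_compare {d : ℕ} (α : ℝ) (hα : 0 ≤ α) (f : EuclideanSpace ℝ (Fin d) → ℝ) (τ ε : ℝ) (hτ : 0 < τ) (hε : 0 < ε)
    (x x0 : EuclideanSpace ℝ (Fin d)) :
    ENNReal.ofReal ((1 + τ) ^ α) * PP f τ x ≤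
      ENNReal.ofReal ((1 + ε) ^ ((d:ℝ)/2) * Real.exp (‖x - x0‖^2 / (2 * τ * ε))) * fstar α f x0 := by
  have h2 : ENNReal.ofReal ((1 + τ) ^ α) ≤ ENNReal.ofReal ((1 + τ * (1 + ε)) ^ α) := by
    refine ENNReal.ofReal_le_ofReal (Real.rpow_le_rpow (by positivity) ?_ hα)
    nlinarith
  calc _ ≤ ENNReal.ofReal ((1 + τ * (1 + ε)) ^ α) *
        (ENNReal.ofReal ((1 + ε) ^ ((d:ℝ)/2) * Real.exp (‖x - x0‖^2 / (2 * τ * ε))) * PP f (τ * (1 + ε)) x0) :=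
        mul_le_mul' h2 (PP_compare f τ ε hτ hε x x0)
    _ = ENNReal.ofReal ((1 + ε) ^ ((d:ℝ)/2) * Real.exp (‖x - x0‖^2 / (2 * τ * ε))) *
        (ENNReal.ofReal ((1 + τ * (1 + ε)) ^ α) * PP f (τ * (1 + ε)) x0) := by ring
    _ ≤ _ := by
      gcongr
      exact le_fstar α f x0 _ (by positivity)

theorem W_small {d : ℕ} (hd : 1 ≤ d) (α : ℝ) (hα : 0 ≤ α) (f : EuclideanSpace ℝ (Fin d) → ℝ) (hf : Continuous f) (τ η : ℝ) (hτ : 0 < τ)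
    (hτ1 : τ ≤ 1) (hη : 0 ≤ η) (x x0 : EuclideanSpace ℝ (Fin d))
    (h : ∀ z, ‖z‖ ≤ 1 → |f (x + z)| ≤ |f (x0 + z)| + η) :
    ENNReal.ofReal ((1 + τ) ^ α) * PP f τ x ≤
      fstar α f x0 + ENNReal.ofReal (2 ^ α * η) + ENNReal.ofReal (2 ^ α * (Ct d * τ)) * PP f 2 x := by
  have hC := Ct_nonneg d
  have h2 : ENNReal.ofReal ((1 + τ) ^ α) ≤ ENNReal.ofReal (2 ^ α) :=
    ENNReal.ofReal_le_ofReal (Real.rpow_le_rpow (by positivity) (by linarith) hα)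
  calc _ ≤ ENNReal.ofReal ((1 + τ) ^ α) * (PP f τ x0 + ENNReal.ofReal η + ENNReal.ofReal (Ct d * τ) * PP f 2 x) := by
        gcongr
        exact PP_small hd f hf τ η hτ hτ1 hη x x0 h
    _ = ENNReal.ofReal ((1 + τ) ^ α) * PP f τ x0 + ENNReal.ofReal ((1 + τ) ^ α) * ENNReal.ofReal η +
        ENNReal.ofReal ((1 + τ) ^ α) * (ENNReal.ofReal (Ct d * τ) * PP f 2 x) := by ring
    _ ≤ fstar α f x0 + ENNReal.ofReal (2 ^ α) * ENNReal.ofReal η +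
        ENNReal.ofReal (2 ^ α) * (ENNReal.ofReal (Ct d * τ) * PP f 2 x) := by
      gcongr
      exact le_fstar α f x0 _ hτ
    _ = _ := by
      rw [ENNReal.ofReal_mul (p := 2 ^ α) (q := η) (by positivity), ENNReal.ofReal_mul (p := 2 ^ α) (q := Ct d * τ) (by positivity)]
      ring

theorem PP_two_le {d : ℕ} (α : ℝ) (hα : 0 ≤ α) (f : EuclideanSpace ℝ (Fin d) → ℝ) (x : EuclideanSpace ℝ (Fin d)) :
    PP f 2 x ≤ ENNReal.ofReal ((1 + 2) ^ α) * PP f 2 x := by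
  apply le_mul_of_one_le_left (by positivity)
  rw [ENNReal.one_le_ofReal]
  exact Real.one_le_rpow (by norm_num) hα

theorem star_bdd {d : ℕ} (hd : 1 ≤ d) (α : ℝ) (hα : 0 ≤ α) (f : EuclideanSpace ℝ (Fin d) → ℝ) (hf : Continuous f)
    (h0 : fstar α f 0 < ⊤) (R : ℝ) (hR : 0 ≤ R) :
    ∃ B : ℝ, 0 ≤ B ∧ ∀ x : EuclideanSpace ℝ (Fin d), ‖x‖ ≤ R → fstar α f x ≤ ENNReal.ofReal B := by
  obtain ⟨M, hM⟩ := (isCompact_closedBall (0 : EuclideanSpace ℝ (Fin d)) (R + 1)).exists_bound_of_continuousOn hf.continuousOn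
  have hM0 : 0 ≤ M := (norm_nonneg _).trans (hM 0 (by simp; linarith))
  have hC := Ct_nonneg d
  set c : ℝ≥0∞ := ENNReal.ofReal ((1 + 1) ^ ((d:ℝ)/2) * Real.exp (R^2 / 2)) * fstar α f 0 with hc
  have hct : c ≠ ⊤ := ENNReal.mul_ne_top ENNReal.ofReal_ne_top h0.ne
  have hbig : ∀ τ : ℝ, 1 ≤ τ → ∀ x : EuclideanSpace ℝ (Fin d), ‖x‖ ≤ R → ENNReal.ofReal ((1 + τ) ^ α) * PP f τ x ≤ c := by
    intro τ hτ x hx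
    refine (W_compare α hα f τ 1 (by linarith) one_pos x 0).trans ?_
    rw [hc]
    gcongr ENNReal.ofReal (_ * Real.exp ?_) * _
    rw [sub_zero, div_le_div_iff₀ (by positivity) (by positivity)]
    have : ‖x‖ ^ 2 ≤ R ^ 2 := by gcongr
    nlinarith [sq_nonneg R]
  set T : ℝ≥0∞ := c + (fstar α f 0 + ENNReal.ofReal (2 ^ α * M) + ENNReal.ofReal (2 ^ α * (Ct d * 1)) * c) with hT
  have hTt : T ≠ ⊤ := by
    simp only [hT, ne_eq, ENNReal.add_eq_top, not_or]
    exact ⟨hct, ⟨h0.ne, ENNReal.ofReal_ne_top⟩, ENNReal.mul_ne_top ENNReal.ofReal_ne_top hct⟩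
  refine ⟨T.toReal, ENNReal.toReal_nonneg, fun x hx => ?_⟩
  rw [ENNReal.ofReal_toReal hTt]
  refine fstar_le α f x _ fun τ hτ => ?_
  rcases le_total 1 τ with h1 | h1
  · exact (hbig τ h1 x hx).trans le_self_add
  · refine (W_small hd α hα f hf τ M hτ h1 hM0 x 0 ?_).trans ?_
    · intro z hz
      have := hM (x + z) (by
        rw [mem_closedBall_zero_iff]
        exact (norm_add_le _ _).trans (by linarith))
      rw [Real.norm_eq_abs] at this
      linarith [abs_nonneg (f (0 + z))]
    · refine le_trans ?_ le_add_self
      gcongr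
      exact (PP_two_le α hα f x).trans (hbig 2 (by norm_num) x hx)

theorem star_main {d : ℕ} (hd : 1 ≤ d) (α : ℝ) (hα : 0 ≤ α) (f : EuclideanSpace ℝ (Fin d) → ℝ) (hf : Continuous f)
    (η : ℝ) (hη : 0 ≤ η) (x x0 : EuclideanSpace ℝ (Fin d)) (hδ : ‖x - x0‖ ≤ 1)
    (h : ∀ z, ‖z‖ ≤ 1 → |f (x + z)| ≤ |f (x0 + z)| + η) :
    fstar α f x ≤ fstar α f x0 + ENNReal.ofReal (√‖x - x0‖ * Real.exp (((d:ℝ) + 1)/2)) * fstar α f x0 +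
      ENNReal.ofReal (2 ^ α * η) + ENNReal.ofReal (2 ^ α * (Ct d * ‖x - x0‖)) * fstar α f x := by
  have hC := Ct_nonneg d
  rcases eq_or_lt_of_le (norm_nonneg (x - x0)) with h0 | h0
  · have : x = x0 := by rw [← sub_eq_zero, ← norm_eq_zero, ← h0]
    subst this
    rw [add_assoc, add_assoc]
    exact le_self_add
  set δ := ‖x - x0‖ with hδd
  have hs : 0 < √δ := Real.sqrt_pos.2 h0
  have hs1 : √δ ≤ 1 := Real.sqrt_le_one.2 hδ
  have hss : √δ * √δ = δ := Real.mul_self_sqrt h0.le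
  refine fstar_le α f x _ fun τ hτ => ?_
  rcases le_total τ δ with h1 | h1
  · refine (W_small hd α hα f hf τ η hτ (h1.trans hδ) hη x x0 h).trans ?_
    gcongr
    · exact le_self_add
    · exact (PP_two_le α hα f x).trans (le_fstar α f x 2 (by norm_num))
  · refine (W_compare α hα f τ (√δ) hτ hs x x0).trans ?_
    rw [add_assoc (fstar α f x0 + _)]
    refine le_trans ?_ le_self_add
    rw [← hδd]
    have hA : (1 + √δ) ^ ((d:ℝ)/2) * Real.exp (δ^2 / (2 * τ * √δ)) ≤ 1 + √δ * Real.exp (((d:ℝ) + 1)/2) := by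
      refine le_trans ?_ (exp_cvx _ _ hs.le hs1)
      have : Real.exp (((d:ℝ) + 1)/2 * √δ) = (Real.exp (√δ)) ^ ((d:ℝ)/2) * Real.exp (√δ / 2) := by
        rw [← Real.exp_mul, ← Real.exp_add]; congr 1; ring
      rw [this]
      refine mul_le_mul (Real.rpow_le_rpow (by positivity) ?_ (by positivity)) (Real.exp_le_exp.2 ?_) (by positivity) (by positivity)
      · linarith [Real.add_one_le_exp (√δ)]
      · rw [div_le_div_iff₀ (by positivity) (by positivity)]
        have : √δ * (2 * τ * √δ) = 2 * τ * δ := by linear_combination (2 * τ) * hss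
        rw [this]
        nlinarith
    calc _ ≤ ENNReal.ofReal (1 + √δ * Real.exp (((d:ℝ) + 1)/2)) * fstar α f x0 := by gcongr
      _ = _ := by
        rw [ENNReal.ofReal_add (by positivity) (by positivity), ENNReal.ofReal_one]
        ring

theorem AA_shift {d : ℕ} (f : EuclideanSpace ℝ (Fin d) → ℝ) (ρ : ℝ) (x : EuclideanSpace ℝ (Fin d)) :
    AA f ρ x = (∫⁻ z in Metric.ball 0 ρ, ENNReal.ofReal |f (x + z)|) / volume (Metric.ball (0 : EuclideanSpace ℝ (Fin d)) ρ) := by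
  unfold AA
  rw [Measure.addHaar_ball_center]
  congr 1
  rw [← lintegral_indicator measurableSet_ball, ← lintegral_indicator measurableSet_ball,
    ← lintegral_add_left_eq_self _ x]
  refine lintegral_congr fun z => ?_
  simp [Set.indicator]

theorem AA_small {d : ℕ} (f : EuclideanSpace ℝ (Fin d) → ℝ) (hf : Continuous f) (ρ η : ℝ) (hρ : 0 < ρ)
    (hρ1 : ρ ≤ 1) (hη : 0 ≤ η) (x x0 : EuclideanSpace ℝ (Fin d))
    (h : ∀ z, ‖z‖ ≤ 1 → |f (x + z)| ≤ |f (x0 + z)| + η) :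
    AA f ρ x ≤ AA f ρ x0 + ENNReal.ofReal η := by
  rw [AA_shift, AA_shift]
  have hv0 : volume (Metric.ball (0 : EuclideanSpace ℝ (Fin d)) ρ) ≠ 0 := (Metric.measure_ball_pos _ _ hρ).ne'
  have hvt : volume (Metric.ball (0 : EuclideanSpace ℝ (Fin d)) ρ) ≠ ⊤ := measure_ball_lt_top.ne
  have : ENNReal.ofReal η = (∫⁻ z in Metric.ball (0 : EuclideanSpace ℝ (Fin d)) ρ, ENNReal.ofReal η) / volume (Metric.ball (0 : EuclideanSpace ℝ (Fin d)) ρ) := by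
    rw [setLIntegral_const, ENNReal.mul_div_cancel_right hv0 hvt]
  rw [this, ← ENNReal.add_div, ← lintegral_add_left (by fun_prop)]
  gcongr ?_ / _
  refine setLIntegral_mono (by fun_prop) fun z hz => ?_
  rw [← ENNReal.ofReal_add (by positivity) hη]
  refine ENNReal.ofReal_le_ofReal (h z ?_)
  rw [mem_ball_zero_iff] at hz
  linarith

theorem AA_big {d : ℕ} (f : EuclideanSpace ℝ (Fin d) → ℝ) (ρ : ℝ) (hρ : 0 < ρ)
    (x x0 : EuclideanSpace ℝ (Fin d)) :
    AA f ρ x ≤ ENNReal.ofReal (((ρ + ‖x - x0‖) / ρ) ^ d) * AA f (ρ + ‖x - x0‖) x0 := by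
  set δ := ‖x - x0‖ with hδ
  have hδ0 : 0 ≤ δ := norm_nonneg _
  have hsub : Metric.ball x ρ ⊆ Metric.ball x0 (ρ + δ) := by
    apply Metric.ball_subset_ball'
    rw [dist_eq_norm]
  unfold AA
  rw [Measure.addHaar_ball_of_pos volume x hρ, Measure.addHaar_ball_of_pos volume x0 (by positivity : 0 < ρ + δ),
    finrank_euclideanSpace_fin, div_pow, ENNReal.ofReal_div_of_pos (by positivity)]
  set v := volume (Metric.ball (0 : EuclideanSpace ℝ (Fin d)) 1)
  have hv0 : v ≠ 0 := (Metric.measure_ball_pos _ _ one_pos).ne'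
  have hvt : v ≠ ⊤ := measure_ball_lt_top.ne
  set a := ENNReal.ofReal (ρ ^ d)
  set b := ENNReal.ofReal ((ρ + δ) ^ d)
  have ha0 : a ≠ 0 := by simp only [a, ne_eq, ENNReal.ofReal_eq_zero, not_le]; positivity
  have hb0 : b ≠ 0 := by simp only [b, ne_eq, ENNReal.ofReal_eq_zero, not_le]; positivity
  have hat : a ≠ ⊤ := ENNReal.ofReal_ne_top
  have hbt : b ≠ ⊤ := ENNReal.ofReal_ne_top
  set I := ∫⁻ y in Metric.ball x0 (ρ + δ), ENNReal.ofReal |f y|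
  calc _ ≤ I / (a * v) := by
        gcongr
        exact lintegral_mono_set hsub
    _ = b / a * (I / (b * v)) := by
      rw [div_eq_mul_inv, div_eq_mul_inv, div_eq_mul_inv, ENNReal.mul_inv (Or.inl ha0) (Or.inl hat),
        ENNReal.mul_inv (Or.inl hb0) (Or.inl hbt)]
      calc I * (a⁻¹ * v⁻¹) = (b * b⁻¹) * (I * (a⁻¹ * v⁻¹)) := by rw [ENNReal.mul_inv_cancel hb0 hbt, one_mul]
        _ = _ := by ring

theorem AA_le_PP {d : ℕ} (f : EuclideanSpace ℝ (Fin d) → ℝ) (ρ : ℝ) (hρ : 0 < ρ)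
    (x : EuclideanSpace ℝ (Fin d)) :
    AA f ρ x ≤ (volume (Metric.ball (0 : EuclideanSpace ℝ (Fin d)) 1))⁻¹ *
      ENNReal.ofReal ((2 * π) ^ ((d:ℝ)/2) * Real.exp (1/2)) * PP f (ρ ^ 2) x := by
  unfold AA
  rw [Measure.addHaar_ball_of_pos volume x hρ, finrank_euclideanSpace_fin]
  set v := volume (Metric.ball (0 : EuclideanSpace ℝ (Fin d)) 1)
  have ha0 : ENNReal.ofReal (ρ ^ d) ≠ 0 := by simp only [ne_eq, ENNReal.ofReal_eq_zero, not_le]; positivity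
  rw [div_eq_mul_inv, ENNReal.mul_inv (Or.inl ha0) (Or.inl ENNReal.ofReal_ne_top),
    ← ENNReal.ofReal_inv_of_pos (by positivity)]
  have key : ENNReal.ofReal (ρ ^ d)⁻¹ * (∫⁻ y in Metric.ball x ρ, ENNReal.ofReal |f y|) ≤
      ENNReal.ofReal ((2 * π) ^ ((d:ℝ)/2) * Real.exp (1/2)) * PP f (ρ ^ 2) x := by
    unfold PP
    rw [← lintegral_const_mul' _ _ ENNReal.ofReal_ne_top, ← lintegral_const_mul' _ _ ENNReal.ofReal_ne_top]
    refine le_trans ?_ (setLIntegral_le_lintegral (Metric.ball x ρ) _)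
    refine setLIntegral_mono' measurableSet_ball fun y hy => ?_
    rw [← ENNReal.ofReal_mul (by positivity), ← ENNReal.ofReal_mul (by positivity)]
    refine ENNReal.ofReal_le_ofReal ?_
    rw [← mul_assoc]
    refine mul_le_mul_of_nonneg_right ?_ (abs_nonneg _)
    have e1 : (2 * π * ρ ^ 2) ^ (-(d:ℝ)/2) = ((2 * π) ^ ((d:ℝ)/2))⁻¹ * (ρ ^ d)⁻¹ := by
      rw [Real.mul_rpow (by positivity) (by positivity), neg_div, Real.rpow_neg (by positivity),
        Real.rpow_neg (by positivity), ← Real.rpow_natCast ρ 2, ← Real.rpow_mul hρ.le, ← Real.rpow_natCast ρ d]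
      congr 3
      push_cast; ring
    have hp : 0 < (2 * π) ^ ((d:ℝ)/2) := by positivity
    have e2 : (2 * π) ^ ((d:ℝ)/2) * Real.exp (1/2) * ((2 * π * ρ ^ 2) ^ (-(d:ℝ)/2) * Real.exp (-‖x - y‖^2 / (2 * ρ ^ 2))) =
        (ρ ^ d)⁻¹ * Real.exp (1/2 + -‖x - y‖^2 / (2 * ρ ^ 2)) := by
      rw [e1, Real.exp_add]; field_simp
    rw [e2]
    refine le_mul_of_one_le_right (by positivity) (Real.one_le_exp ?_)
    have : ‖x - y‖ ≤ ρ := by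
      rw [Metric.mem_ball, dist_comm, dist_eq_norm] at hy
      exact hy.le
    have h2 : ‖x - y‖ ^ 2 ≤ ρ ^ 2 := by gcongr
    have : 1/2 + -‖x - y‖^2 / (2 * ρ ^ 2) = (ρ ^ 2 - ‖x - y‖ ^ 2) / (2 * ρ ^ 2) := by
      field_simp; ring
    rw [this]
    exact div_nonneg (by linarith) (by positivity)
  calc _ = v⁻¹ * (ENNReal.ofReal (ρ ^ d)⁻¹ * (∫⁻ y in Metric.ball x ρ, ENNReal.ofReal |f y|)) := by ring
    _ ≤ _ := by rw [mul_assoc]; gcongr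

theorem sharp_le_star {d : ℕ} (α : ℝ) (f : EuclideanSpace ℝ (Fin d) → ℝ) :
    ∃ K : ℝ, 0 ≤ K ∧ ∀ x, fsharp α f x ≤ ENNReal.ofReal K * fstar α f x := by
  set k := (volume (Metric.ball (0 : EuclideanSpace ℝ (Fin d)) 1))⁻¹ *
      ENNReal.ofReal ((2 * π) ^ ((d:ℝ)/2) * Real.exp (1/2)) with hk
  have hkt : k ≠ ⊤ := ENNReal.mul_ne_top
    (ENNReal.inv_ne_top.2 (Metric.measure_ball_pos _ _ one_pos).ne') ENNReal.ofReal_ne_top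
  refine ⟨k.toReal, ENNReal.toReal_nonneg, fun x => ?_⟩
  rw [ENNReal.ofReal_toReal hkt]
  refine fsharp_le α f x _ fun ρ hρ => ?_
  calc _ ≤ ENNReal.ofReal ((1 + ρ ^ 2) ^ α) * (k * PP f (ρ ^ 2) x) := by
        gcongr; exact AA_le_PP f ρ hρ x
    _ = k * (ENNReal.ofReal ((1 + ρ ^ 2) ^ α) * PP f (ρ ^ 2) x) := by ring
    _ ≤ _ := by gcongr; exact le_fstar α f x _ (by positivity)

theorem sharp_main {d : ℕ} (α : ℝ) (hα : 0 ≤ α) (f : EuclideanSpace ℝ (Fin d) → ℝ) (hf : Continuous f)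
    (η : ℝ) (hη : 0 ≤ η) (x x0 : EuclideanSpace ℝ (Fin d)) (hδ : ‖x - x0‖ ≤ 1)
    (h : ∀ z, ‖z‖ ≤ 1 → |f (x + z)| ≤ |f (x0 + z)| + η) :
    fsharp α f x ≤ fsharp α f x0 + ENNReal.ofReal (‖x - x0‖ * Real.exp d) * fsharp α f x0 +
      ENNReal.ofReal (2 ^ α * η) := by
  refine fsharp_le α f x _ fun ρ hρ => ?_
  rcases le_total ρ 1 with h1 | h1
  · have h2 : ENNReal.ofReal ((1 + ρ ^ 2) ^ α) ≤ ENNReal.ofReal (2 ^ α) :=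
      ENNReal.ofReal_le_ofReal (Real.rpow_le_rpow (by positivity) (by nlinarith) hα)
    calc _ ≤ ENNReal.ofReal ((1 + ρ ^ 2) ^ α) * (AA f ρ x0 + ENNReal.ofReal η) := by
          gcongr; exact AA_small f hf ρ η hρ h1 hη x x0 h
      _ = ENNReal.ofReal ((1 + ρ ^ 2) ^ α) * AA f ρ x0 + ENNReal.ofReal ((1 + ρ ^ 2) ^ α) * ENNReal.ofReal η := by ring
      _ ≤ _ := by
        rw [ENNReal.ofReal_mul (p := 2 ^ α) (by positivity)]
        gcongr
        exact (le_fsharp α f x0 ρ hρ).trans le_self_add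
  · refine le_trans ?_ le_self_add
    set δ := ‖x - x0‖
    have hδ0 : 0 ≤ δ := norm_nonneg _
    have hA : ((ρ + δ) / ρ) ^ d ≤ 1 + δ * Real.exp d := by
      refine le_trans ?_ (exp_cvx _ _ hδ0 hδ)
      rw [Real.exp_nat_mul]
      have : (ρ + δ) / ρ ≤ δ + 1 := by
        rw [div_le_iff₀ hρ]; nlinarith
      have h3 := this.trans (Real.add_one_le_exp δ)
      gcongr
    have h2 : ENNReal.ofReal ((1 + ρ ^ 2) ^ α) ≤ ENNReal.ofReal ((1 + (ρ + δ) ^ 2) ^ α) :=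
      ENNReal.ofReal_le_ofReal (Real.rpow_le_rpow (by positivity) (by nlinarith) hα)
    calc _ ≤ ENNReal.ofReal ((1 + (ρ + δ) ^ 2) ^ α) * (ENNReal.ofReal (((ρ + δ) / ρ) ^ d) * AA f (ρ + δ) x0) :=
          mul_le_mul' h2 (AA_big f ρ hρ x x0)
      _ = ENNReal.ofReal (((ρ + δ) / ρ) ^ d) * (ENNReal.ofReal ((1 + (ρ + δ) ^ 2) ^ α) * AA f (ρ + δ) x0) := by ring
      _ ≤ ENNReal.ofReal (1 + δ * Real.exp d) * fsharp α f x0 := by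
        gcongr
        exact le_fsharp α f x0 _ (by positivity)
      _ = _ := by
        rw [ENNReal.ofReal_add (by positivity) (by positivity), ENNReal.ofReal_one]
        ring

theorem star_B {d : ℕ} (hd : 1 ≤ d) (α : ℝ) (hα : 0 ≤ α) (f : EuclideanSpace ℝ (Fin d) → ℝ) (hf : Continuous f)
    (h0 : fstar α f 0 < ⊤) (R : ℝ) (hR : 0 ≤ R) :
    ∃ B : ℝ, 0 ≤ B ∧ ∀ x : EuclideanSpace ℝ (Fin d), ‖x‖ ≤ R → 0 ≤ (fstar α f x).toReal ∧ (fstar α f x).toReal ≤ B := by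
  obtain ⟨B, hB0, hB⟩ := star_bdd hd α hα f hf h0 R hR
  exact ⟨B, hB0, fun x hx => ⟨ENNReal.toReal_nonneg, ENNReal.toReal_le_of_le_ofReal hB0 (hB x hx)⟩⟩

theorem sharp_B {d : ℕ} (hd : 1 ≤ d) (α : ℝ) (hα : 0 ≤ α) (f : EuclideanSpace ℝ (Fin d) → ℝ) (hf : Continuous f)
    (h0 : fstar α f 0 < ⊤) (R : ℝ) (hR : 0 ≤ R) :
    ∃ B : ℝ, 0 ≤ B ∧ ∀ x : EuclideanSpace ℝ (Fin d), ‖x‖ ≤ R → 0 ≤ (fsharp α f x).toReal ∧ (fsharp α f x).toReal ≤ B := by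
  obtain ⟨B, hB0, hB⟩ := star_bdd hd α hα f hf h0 R hR
  obtain ⟨K, hK0, hK⟩ := sharp_le_star α f
  refine ⟨K * B, by positivity, fun x hx => ⟨ENNReal.toReal_nonneg, ENNReal.toReal_le_of_le_ofReal (by positivity) ?_⟩⟩
  rw [ENNReal.ofReal_mul hK0]
  refine (hK x).trans ?_
  gcongr
  exact hB x hx

theorem star_C {d : ℕ} (hd : 1 ≤ d) (α : ℝ) (hα : 0 ≤ α) (f : EuclideanSpace ℝ (Fin d) → ℝ) (hf : Continuous f)
    (hfin : ∀ x, fstar α f x < ⊤) (R : ℝ) (hR : 0 ≤ R) :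
    ∃ C : ℝ, 0 ≤ C ∧ ∀ x x0 : EuclideanSpace ℝ (Fin d), ‖x‖ ≤ R → ‖x0‖ ≤ R → ‖x - x0‖ ≤ 1 → ∀ η : ℝ, 0 ≤ η →
      (∀ z, ‖z‖ ≤ 1 → |f (x + z)| ≤ |f (x0 + z)| + η) →
      (fstar α f x).toReal ≤ (fstar α f x0).toReal + C * (√‖x - x0‖ + η) := by
  obtain ⟨B, hB0, hB⟩ := star_B hd α hα f hf (hfin 0) R hR
  have hC := Ct_nonneg d
  refine ⟨Real.exp (((d:ℝ) + 1)/2) * B + 2 ^ α + 2 ^ α * Ct d * B, by positivity, fun x x0 hx hx0 hδ η hη h => ?_⟩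
  have hm := star_main hd α hα f hf η hη x x0 hδ h
  obtain ⟨hx1, hx2⟩ := hB x hx
  obtain ⟨hy1, hy2⟩ := hB x0 hx0
  rw [← ENNReal.ofReal_toReal (hfin x).ne, ← ENNReal.ofReal_toReal (hfin x0).ne,
    ← ENNReal.ofReal_mul (by positivity), ← ENNReal.ofReal_mul (by positivity),
    ← ENNReal.ofReal_add (by positivity) (by positivity), ← ENNReal.ofReal_add (by positivity) (by positivity),
    ← ENNReal.ofReal_add (by positivity) (by positivity), ENNReal.ofReal_le_ofReal_iff (by positivity)] at hm
  have hs0 : 0 ≤ √‖x - x0‖ := Real.sqrt_nonneg _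
  have hs1 : √‖x - x0‖ ≤ 1 := Real.sqrt_le_one.2 hδ
  have hss : √‖x - x0‖ * √‖x - x0‖ = ‖x - x0‖ := Real.mul_self_sqrt (norm_nonneg _)
  have hs2 : ‖x - x0‖ ≤ √‖x - x0‖ := by nlinarith
  refine hm.trans ?_
  set s := √‖x - x0‖
  set e := Real.exp (((d:ℝ) + 1)/2) with he
  have he0 : 0 < e := Real.exp_pos _
  have a1 : s * e * (fstar α f x0).toReal ≤ s * e * B := by gcongr
  have a2 : 2 ^ α * (Ct d * ‖x - x0‖) * (fstar α f x).toReal ≤ 2 ^ α * (Ct d * s) * B := by gcongr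
  have a3 : 0 ≤ e * B * η + 2 ^ α * s + 2 ^ α * Ct d * B * η := by positivity
  nlinarith

theorem sharp_C {d : ℕ} (hd : 1 ≤ d) (α : ℝ) (hα : 0 ≤ α) (f : EuclideanSpace ℝ (Fin d) → ℝ) (hf : Continuous f)
    (hfin : ∀ x, fstar α f x < ⊤) (R : ℝ) (hR : 0 ≤ R) :
    ∃ C : ℝ, 0 ≤ C ∧ ∀ x x0 : EuclideanSpace ℝ (Fin d), ‖x‖ ≤ R → ‖x0‖ ≤ R → ‖x - x0‖ ≤ 1 → ∀ η : ℝ, 0 ≤ η →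
      (∀ z, ‖z‖ ≤ 1 → |f (x + z)| ≤ |f (x0 + z)| + η) →
      (fsharp α f x).toReal ≤ (fsharp α f x0).toReal + C * (√‖x - x0‖ + η) := by
  obtain ⟨B, hB0, hB⟩ := sharp_B hd α hα f hf (hfin 0) R hR
  obtain ⟨K, hK0, hK⟩ := sharp_le_star α f
  have hfin2 : ∀ x, fsharp α f x ≠ ⊤ := fun x =>
    ne_top_of_le_ne_top (ENNReal.mul_ne_top ENNReal.ofReal_ne_top (hfin x).ne) (hK x)
  refine ⟨Real.exp d * B + 2 ^ α, by positivity, fun x x0 hx hx0 hδ η hη h => ?_⟩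
  have hm := sharp_main α hα f hf η hη x x0 hδ h
  obtain ⟨hx1, hx2⟩ := hB x hx
  obtain ⟨hy1, hy2⟩ := hB x0 hx0
  rw [← ENNReal.ofReal_toReal (hfin2 x), ← ENNReal.ofReal_toReal (hfin2 x0),
    ← ENNReal.ofReal_mul (by positivity),
    ← ENNReal.ofReal_add (by positivity) (by positivity),
    ← ENNReal.ofReal_add (by positivity) (by positivity), ENNReal.ofReal_le_ofReal_iff (by positivity)] at hm
  have hs0 : 0 ≤ √‖x - x0‖ := Real.sqrt_nonneg _
  have hs1 : √‖x - x0‖ ≤ 1 := Real.sqrt_le_one.2 hδ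
  have hss : √‖x - x0‖ * √‖x - x0‖ = ‖x - x0‖ := Real.mul_self_sqrt (norm_nonneg _)
  have hs2 : ‖x - x0‖ ≤ √‖x - x0‖ := by nlinarith
  refine hm.trans ?_
  set s := √‖x - x0‖
  have a1 : ‖x - x0‖ * Real.exp d * (fsharp α f x0).toReal ≤ s * Real.exp d * B := by gcongr
  have a3 : 0 ≤ Real.exp d * B * η + 2 ^ α * s := by positivity
  nlinarith

theorem final {d : ℕ} (f : EuclideanSpace ℝ (Fin d) → ℝ) (hf : Continuous f) (F : EuclideanSpace ℝ (Fin d) → ℝ)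
    (hB : ∀ R : ℝ, 0 ≤ R → ∃ B : ℝ, 0 ≤ B ∧ ∀ x : EuclideanSpace ℝ (Fin d), ‖x‖ ≤ R → 0 ≤ F x ∧ F x ≤ B)
    (hM : ∀ R : ℝ, 0 ≤ R → ∃ C : ℝ, 0 ≤ C ∧ ∀ x x0 : EuclideanSpace ℝ (Fin d), ‖x‖ ≤ R → ‖x0‖ ≤ R → ‖x - x0‖ ≤ 1 → ∀ η : ℝ, 0 ≤ η →
      (∀ z, ‖z‖ ≤ 1 → |f (x + z)| ≤ |f (x0 + z)| + η) → F x ≤ F x0 + C * (√‖x - x0‖ + η)) :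
    Continuous F ∧ ∀ γ : ℝ, 0 < γ → γ ≤ 1 →
      (∀ K : Set (EuclideanSpace ℝ (Fin d)), IsCompact K →
          ∃ C, ∀ x ∈ K, ∀ y ∈ K, |f x - f y| ≤ C * ‖x - y‖ ^ γ) →
      ∀ K : Set (EuclideanSpace ℝ (Fin d)), IsCompact K →
        ∃ C, ∀ x ∈ K, ∀ y ∈ K, |F x - F y| ≤ C * ‖x - y‖ ^ (γ / (1 + γ)) := by
  have hM2 : ∀ R : ℝ, 0 ≤ R → ∃ C : ℝ, 0 ≤ C ∧ ∀ x x0 : EuclideanSpace ℝ (Fin d), ‖x‖ ≤ R → ‖x0‖ ≤ R → ‖x - x0‖ ≤ 1 → ∀ η : ℝ, 0 ≤ η →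
      (∀ z, ‖z‖ ≤ 1 → |f (x + z) - f (x0 + z)| ≤ η) → |F x - F x0| ≤ C * (√‖x - x0‖ + η) := by
    intro R hR
    obtain ⟨C, hC, h⟩ := hM R hR
    refine ⟨C, hC, fun x x0 hx hx0 hδ η hη hz => ?_⟩
    have a := h x x0 hx hx0 hδ η hη fun z hz1 => by
      linarith [hz z hz1, abs_sub_abs_le_abs_sub (f (x + z)) (f (x0 + z))]
    have b := h x0 x hx0 hx (by rwa [norm_sub_rev]) η hη fun z hz1 => by
      have := hz z hz1
      rw [abs_sub_comm] at this
      linarith [abs_sub_abs_le_abs_sub (f (x0 + z)) (f (x + z))]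
    rw [norm_sub_rev x0 x] at b
    rw [abs_le]
    constructor <;> linarith
  constructor
  · rw [continuous_iff_continuousAt]
    intro x0
    rw [Metric.continuousAt_iff]
    intro ε hε
    obtain ⟨C, hC, h⟩ := hM2 (‖x0‖ + 1) (by positivity)
    have hu := (isCompact_closedBall (0 : EuclideanSpace ℝ (Fin d)) (‖x0‖ + 1 + 1)).uniformContinuousOn_of_continuous hf.continuousOn
    rw [Metric.uniformContinuousOn_iff] at hu
    set κ := ε / (4 * (C + 1)) with hκ
    have hκ0 : 0 < κ := by positivity
    obtain ⟨δ, hδ, hd⟩ := hu κ hκ0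
    refine ⟨min δ (min 1 (κ ^ 2)), by positivity, fun {x} hx => ?_⟩
    rw [lt_min_iff, lt_min_iff] at hx
    obtain ⟨h1, h2, h3⟩ := hx
    have hx1 : ‖x‖ ≤ ‖x0‖ + 1 := by
      rw [dist_eq_norm] at h2
      have := norm_le_norm_add_norm_sub' x x0
      linarith
    have hk := h x x0 hx1 (by linarith) (by rw [← dist_eq_norm]; exact h2.le) κ hκ0.le fun z hz => by
      have := hd (x + z) (by rw [mem_closedBall_zero_iff]; exact (norm_add_le _ _).trans (by linarith)) (x0 + z)
        (by rw [mem_closedBall_zero_iff]; exact (norm_add_le _ _).trans (by linarith)) (by simpa using h1)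
      rw [Real.dist_eq] at this
      exact this.le
    have hsq : √‖x - x0‖ ≤ κ := by
      rw [← dist_eq_norm]
      exact (Real.sqrt_le_sqrt h3.le).trans (by rw [Real.sqrt_sq hκ0.le])
    rw [Real.dist_eq]
    have : κ * (4 * (C + 1)) = ε := by rw [hκ]; field_simp
    nlinarith [mul_le_mul_of_nonneg_left hsq hC]
  · intro γ hγ hγ1 hH K hK
    obtain ⟨R0, hR0⟩ := hK.isBounded.exists_norm_le
    set R := max R0 0
    have hR : 0 ≤ R := le_max_right _ _
    have hKR : ∀ x ∈ K, ‖x‖ ≤ R := fun x hx => (hR0 x hx).trans (le_max_left _ _)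
    obtain ⟨B, hB0, hB⟩ := hB R hR
    obtain ⟨C, hC, h⟩ := hM2 R hR
    obtain ⟨H, hHH⟩ := hH _ (isCompact_closedBall (0 : EuclideanSpace ℝ (Fin d)) (R + 1))
    refine ⟨B + C * (1 + |H|), fun x hx y hy => ?_⟩
    have hq0 : 0 ≤ γ / (1 + γ) := by positivity
    obtain ⟨b1, b2⟩ := hB x (hKR x hx)
    obtain ⟨b3, b4⟩ := hB y (hKR y hy)
    set δ := ‖x - y‖ with hδd
    have hδ0 : 0 ≤ δ := norm_nonneg _
    have hCH : 0 ≤ C * (1 + |H|) := by positivity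
    have hp : 0 ≤ δ ^ (γ / (1 + γ)) := by positivity
    rcases le_total δ 1 with h1 | h1
    · have hk := h x y (hKR x hx) (hKR y hy) h1 (|H| * δ ^ γ) (by positivity) fun z hz => by
        have := hHH (x + z) (by rw [mem_closedBall_zero_iff]; exact (norm_add_le _ _).trans (by linarith [hKR x hx])) (y + z)
          (by rw [mem_closedBall_zero_iff]; exact (norm_add_le _ _).trans (by linarith [hKR y hy]))
        rw [add_sub_add_right_eq_sub] at this
        refine this.trans ?_
        gcongr
        exact le_abs_self H
      refine hk.trans ?_
      have e1 : √δ ≤ δ ^ (γ / (1 + γ)) := by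
        rw [Real.sqrt_eq_rpow]
        apply Real.rpow_le_rpow_of_exponent_ge_of_imp hδ0 h1
        · rw [div_le_div_iff₀ (by positivity) (by positivity)]; linarith
        · intro _ h; exfalso; have : 0 < γ / (1 + γ) := by positivity
          first | linarith | norm_num at h
      have e2 : δ ^ γ ≤ δ ^ (γ / (1 + γ)) := by
        apply Real.rpow_le_rpow_of_exponent_ge_of_imp hδ0 h1
        · exact div_le_self hγ.le (by linarith)
        · intro _ h; exfalso; have : 0 < γ / (1 + γ) := by positivity
          linarith
      calc C * (√δ + |H| * δ ^ γ) ≤ C * (δ ^ (γ / (1 + γ)) + |H| * δ ^ (γ / (1 + γ))) := by gcongr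
        _ = C * (1 + |H|) * δ ^ (γ / (1 + γ)) := by ring
        _ ≤ _ := by gcongr; linarith
    · have hone : 1 ≤ δ ^ (γ / (1 + γ)) := Real.one_le_rpow h1 hq0
      have : |F x - F y| ≤ B := by rw [abs_le]; constructor <;> linarith
      nlinarith

/-- Let `f ∈ H⁰_α` be continuous. Then (1) `f*_α` and `f♯_α` are continuous;
(2) if moreover `f` is locally `γ`-Hölder for some `γ ∈ (0,1]`, then `f*_α` and `f♯_α` are
locally Hölder with exponent `γ/(1+γ)`. -/
theorem statement9 {d : ℕ} (hd : 1 ≤ d) (α : ℝ) (hα : 0 ≤ α)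
    (f : EuclideanSpace ℝ (Fin d) → ℝ) (hf : Continuous f) (hmem : MemH0 α f) :
    (Continuous fun x => (fstar α f x).toReal) ∧
    (Continuous fun x => (fsharp α f x).toReal) ∧
    ∀ γ : ℝ, 0 < γ → γ ≤ 1 →
      (∀ K : Set (EuclideanSpace ℝ (Fin d)), IsCompact K →
          ∃ C, ∀ x ∈ K, ∀ y ∈ K, |f x - f y| ≤ C * ‖x - y‖ ^ γ) →
      ∀ K : Set (EuclideanSpace ℝ (Fin d)), IsCompact K →
        ∃ C, ∀ x ∈ K, ∀ y ∈ K,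
          |(fstar α f x).toReal - (fstar α f y).toReal| ≤ C * ‖x - y‖ ^ (γ / (1 + γ)) ∧
          |(fsharp α f x).toReal - (fsharp α f y).toReal| ≤ C * ‖x - y‖ ^ (γ / (1 + γ)) := by
  obtain ⟨K0, hK0, hK⟩ := sharp_le_star α f
  have h1 := final f hf (fun x => (fstar α f x).toReal) (star_B hd α hα f hf (hmem.2 0)) (star_C hd α hα f hf hmem.2)
  have h2 := final f hf (fun x => (fsharp α f x).toReal) (sharp_B hd α hα f hf (hmem.2 0)) (sharp_C hd α hα f hf hmem.2)
  refine ⟨h1.1, h2.1, fun γ hγ hγ1 hH K hKc => ?_⟩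
  obtain ⟨C1, hC1⟩ := h1.2 γ hγ hγ1 hH K hKc
  obtain ⟨C2, hC2⟩ := h2.2 γ hγ hγ1 hH K hKc
  refine ⟨max C1 C2, fun x hx y hy => ⟨?_, ?_⟩⟩
  · refine (hC1 x hx y hy).trans ?_
    gcongr
    exact le_max_left _ _
  · refine (hC2 x hx y hy).trans ?_
    gcongr
    exact le_max_right _ _
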